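/- Let l₁, l₂, l₃, l₄ be four distinct lines in Pic S₈ that pairwise intersect in 1, with center D = l₁ + l₂ + l₃ + l₄. Then there exist eight lines m₁, …, m₈ that pairwise intersect in 0 with 3D + 4K = m₁ + ⋯ + m₈ (i.e., 3D + 4K is a skew 8-line) if and only if the A₃⁸(1)-polytope {l₁, l₂, l₃, l₄} is uncornered. -/

import Mathlib

/-!
Picard lattice of the degree 1 del Pezzo surface S₈:
Pic S₈ = ℤh ⊕ ℤe₁ ⊕ ⋯ ⊕ ℤe₈ ≅ ℤ⁹, with intersection pairing
h·h = 1, h·eᵢ = 0, eᵢ·eⱼ = −δᵢⱼ, and canonical class K = −3h + e₁ + ⋯ + e₈.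
-/

namespace DelPezzo

/-- The Picard lattice `Pic S₈ ≅ ℤ⁹`; coordinate `0` is the `h`-coordinate and
coordinates `1,…,8` are the `e₁,…,e₈`-coordinates. -/
abbrev Pic : Type := Fin 9 → ℤ

/-- The intersection pairing on `Pic S₈` (signature `(1,-8)`). -/
def inter (x y : Pic) : ℤ := x 0 * y 0 - ∑ i : Fin 8, x i.succ * y i.succ

/-- The canonical class `K = -3h + e₁ + ⋯ + e₈`. -/
def K : Pic := fun i => if i = 0 then -3 else 1

/-- A line: a class `l` with `l·l = -1` and `l·K = -1`. -/
def IsLine (l : Pic) : Prop := inter l l = -1 ∧ inter l K = -1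

theorem inter_comm (x y : Pic) : inter x y = inter y x := by
  simp only [inter, mul_comm]

theorem inter_add_left (x y z : Pic) : inter (x + y) z = inter x z + inter y z := by
  simp only [inter, Fin.sum_univ_eight, Pi.add_apply]; ring

theorem inter_sub_left (x y z : Pic) : inter (x - y) z = inter x z - inter y z := by
  simp only [inter, Fin.sum_univ_eight, Pi.sub_apply]; ring

theorem inter_smul_left (n : ℕ) (x z : Pic) : inter (n • x) z = n * inter x z := by
  simp only [inter, Fin.sum_univ_eight, Pi.smul_apply, nsmul_eq_mul]; ring

theorem inter_add_right (x y z : Pic) : inter x (y + z) = inter x y + inter x z := by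
  simp only [inter_comm x, inter_add_left]

theorem inter_sub_right (x y z : Pic) : inter x (y - z) = inter x y - inter x z := by
  simp only [inter_comm x, inter_sub_left]

theorem inter_smul_right (n : ℕ) (x z : Pic) : inter x (n • z) = n * inter x z := by
  simp only [inter_comm x, inter_smul_left]

theorem inter_sum_right {ι : Type*} (s : Finset ι) (x : Pic) (f : ι → Pic) :
    inter x (∑ i ∈ s, f i) = ∑ i ∈ s, inter x (f i) := by
  classical
  induction s using Finset.induction_on with
  | empty => simp [inter]
  | insert a s ha ih => rw [Finset.sum_insert ha, Finset.sum_insert ha, inter_add_right, ih]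

theorem inter_K_K : inter K K = 1 := by decide

/-- The pairing is negative definite on the orthogonal complement of `K`. -/
theorem inter_self_le {x : Pic} (h : inter x K = 0) : 8 * inter x x ≤ -x 0 ^ 2 := by
  have hs : (∑ i : Fin 8, x i.succ) = -3 * x 0 := by
    simp [inter, K, Fin.succ_ne_zero] at h
    linarith
  have hc := sq_sum_le_card_mul_sum_sq (s := Finset.univ) (f := fun i : Fin 8 => x i.succ)
  simp only [hs, Finset.card_univ, Fintype.card_fin] at hc
  simp only [inter, ← sq]
  push_cast at hc
  linarith

theorem inter_self_nonpos {x : Pic} (h : inter x K = 0) : inter x x ≤ 0 := by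
  nlinarith [inter_self_le h, sq_nonneg (x 0)]

theorem eq_zero_of_inter_self {x : Pic} (h : inter x K = 0) (hx : inter x x = 0) : x = 0 := by
  have h0 : x 0 = 0 := by
    have := inter_self_le h
    exact pow_eq_zero_iff two_ne_zero |>.1 (le_antisymm (by linarith) (sq_nonneg _))
  have hs : ∑ i : Fin 8, x i.succ * x i.succ = 0 := by
    simpa [inter, h0] using hx
  rw [Finset.sum_eq_zero_iff_of_nonneg fun i _ => mul_self_nonneg _] at hs
  ext i
  refine Fin.cases h0 (fun j => ?_) i
  exact mul_self_eq_zero.1 (hs j (Finset.mem_univ j))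

/-- A root: a class `r` with `r·r = -2` that is orthogonal to `K`. -/
def IsRoot (r : Pic) : Prop := inter r r = -2 ∧ inter r K = 0

instance (r : Pic) : Decidable (IsRoot r) := inferInstanceAs (Decidable (_ ∧ _))

theorem IsLine.isRoot {l : Pic} (h : IsLine l) : IsRoot (l + K) := by
  have := inter_comm l K
  constructor <;> simp only [inter_add_left, inter_add_right, inter_K_K] <;>
    linarith [h.1, h.2]

theorem IsRoot.isLine {r : Pic} (h : IsRoot r) : IsLine (r - K) := by
  have := inter_comm r K
  constructor <;> simp only [inter_sub_left, inter_sub_right, inter_K_K] <;>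
    linarith [h.1, h.2]

/-- Roots with odd pairing have pairing `±1`. -/
theorem IsRoot.inter_eq_of_odd {r s : Pic} (hr : IsRoot r) (hs : IsRoot s)
    (h : Odd (inter r s)) : inter r s = 1 ∨ inter r s = -1 := by
  have hc := inter_comm r s
  have h1 := inter_self_nonpos (x := r + s) (by rw [inter_add_left, hr.2, hs.2, add_zero])
  have h2 := inter_self_nonpos (x := r - s) (by rw [inter_sub_left, hr.2, hs.2, sub_zero])
  simp only [inter_add_left, inter_add_right, inter_sub_left, inter_sub_right, hr.1, hs.1]
    at h1 h2
  obtain ⟨k, hk⟩ := h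
  omega

/-- The sign `(-1)ⁿ`. -/
def sgn (n : ℤ) : ℤ := 1 - 2 * (n % 2)

theorem sgn_add (m n : ℤ) : sgn (m + n) = sgn m * sgn n := by
  unfold sgn
  rcases Int.emod_two_eq_zero_or_one m with hm | hm <;>
    rcases Int.emod_two_eq_zero_or_one n with hn | hn <;>
    simp [Int.add_emod, hm, hn]

theorem sgn_add_two_mul (m n : ℤ) : sgn (m + 2 * n) = sgn m := by
  simp [sgn]

theorem sgn_eq_one_or_odd (n : ℤ) : sgn n = 1 ∨ Odd n := by
  rcases Int.emod_two_eq_zero_or_one n with h | h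
  · simp [sgn, h]
  · exact Or.inr (Int.odd_iff.2 h)

/-- The class `d h - ∑ i ∈ T, eᵢ`. -/
def hyper (d : ℤ) (T : List (Fin 8)) : Pic :=
  Pi.single 0 d - (T.map fun i => (Pi.single i.succ 1 : Pic)).sum

theorem inter_hyper (d : ℤ) (T : List (Fin 8)) (x : Pic) :
    inter (hyper d T) x = d * x 0 + (T.map fun i => x i.succ).sum := by
  have h : ∀ i : Fin 8, inter (Pi.single i.succ 1 : Pic) x = -x i.succ := fun i => by
    simp [inter, Pi.single_apply, (Fin.succ_ne_zero _).symm]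
  rw [hyper, inter_sub_left]
  have h0 : inter (Pi.single 0 d) x = d * x 0 := by
    simp [inter, Fin.succ_ne_zero]
  rw [h0, sub_eq_add_neg]
  congr 1
  induction T with
  | nil => simp [inter]
  | cons a T ih => simp only [List.map_cons, List.sum_cons, inter_add_left, h, neg_add, ih, neg_neg]

/-- The classes `d h - ∑ i ∈ T, eᵢ + 2 v(T)`, where `T` runs over the `k`-element subsets. -/
def family (k : ℕ) (d : ℤ) (v : List (Fin 8) → Pic) : List Pic :=
  ((List.finRange 8).sublistsLen k).map fun T => hyper d T + 2 • v T

/-- The 120 positive roots, one from each pair `±r`. -/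
def posRoots : List Pic :=
  family 2 0 (fun T => -hyper 0 (T.take 1)) ++ family 3 1 0 ++ family 6 2 0 ++
    family 7 3 (fun T => hyper 0 (List.finRange 8) - hyper 0 T)

theorem isRoot_of_mem_posRoots : ∀ r ∈ posRoots, IsRoot r := by decide +kernel

theorem length_posRoots : posRoots.length = 120 := by decide +kernel

/-- Elementary symmetric functions of a list of integers. -/
def esymm : List ℤ → ℕ → ℤ
  | _, 0 => 1
  | [], _ + 1 => 0
  | a :: l, k + 1 => esymm l (k + 1) + a * esymm l k

theorem sum_sublistsLen_prod {ι : Type*} (y : ι → ℤ) (l : List ι) (k : ℕ) :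
    ((l.sublistsLen k).map fun T => (T.map y).prod).sum = esymm (l.map y) k := by
  induction l generalizing k with
  | nil => cases k <;> simp [esymm]
  | cons a l ih =>
    cases k with
    | zero => simp [esymm]
    | succ k =>
      simp only [List.sublistsLen_succ_cons, List.map_append, List.sum_append, ih, List.map_map,
        List.map_cons, esymm]
      congr 1
      rw [← ih k, ← List.sum_map_mul_left]
      simp [Function.comp_def]

theorem sgn_sum (l : List ℤ) : sgn l.sum = (l.map sgn).prod := by
  induction l with
  | nil => rfl
  | cons a l ih => rw [List.sum_cons, sgn_add, ih, List.map_cons, List.prod_cons]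

/-- The character sum over the positive roots attached to `x` mod 2. -/
def charSum (x : Pic) : ℤ := (posRoots.map fun r => sgn (inter r x)).sum

theorem sum_family (k : ℕ) (d : ℤ) (v : List (Fin 8) → Pic) (x : Pic) :
    ((family k d v).map fun r => sgn (inter r x)).sum =
      sgn (d * x 0) * esymm ((List.finRange 8).map fun i => sgn (x i.succ)) k := by
  rw [← sum_sublistsLen_prod, ← List.sum_map_mul_left, family, List.map_map]
  congr 2
  ext T
  simp only [Function.comp_apply, inter_add_left, inter_smul_left, Nat.cast_ofNat,
    sgn_add_two_mul]
  rw [inter_hyper, sgn_add, sgn_sum, List.map_map, Function.comp_def]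

/-- The value of the character sum in terms of the residues mod 2. -/
def charVal (c : Fin 9 → Bool) : ℤ :=
  let y := (List.finRange 8).map fun i => 1 - 2 * (c i.succ).toInt
  esymm y 2 + esymm y 6 + (1 - 2 * (c 0).toInt) * (esymm y 3 + esymm y 7)

theorem charVal_bounds (b0 b1 b2 b3 b4 b5 b6 b7 b8 : Bool) :
    -8 ≤ charVal ![b0, b1, b2, b3, b4, b5, b6, b7, b8] ∧
    ((b0.toInt - (b1.toInt + b2.toInt + b3.toInt + b4.toInt + b5.toInt + b6.toInt + b7.toInt
      + b8.toInt)) % 4 = 3 → charVal ![b0, b1, b2, b3, b4, b5, b6, b7, b8] ≤ 8) := by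
  revert b0 b1 b2 b3 b4 b5 b6 b7 b8
  decide +kernel

theorem charSum_eq_charVal (x : Pic) : charSum x = charVal fun i => decide (Odd (x i)) := by
  have h : ∀ n : ℤ, 1 - 2 * (decide (Odd n)).toInt = sgn n := fun n => by
    rcases Int.emod_two_eq_zero_or_one n with hn | hn <;> simp [sgn, Int.odd_iff, hn]
  have h1 : sgn (1 * x 0) = sgn (x 0) := by rw [one_mul]
  have h0 : sgn (0 * x 0) = 1 := by simp [sgn]
  have h2 : sgn (2 * x 0) = 1 := by simp [sgn]
  have h3 : sgn (3 * x 0) = sgn (x 0) := by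
    rw [show 3 * x 0 = x 0 + 2 * x 0 by ring, sgn_add_two_mul]
  simp only [charSum, posRoots, List.map_append, List.sum_append, sum_family, charVal, h,
    h0, h1, h2, h3]
  ring

theorem charSum_bounds (x : Pic) :
    -8 ≤ charSum x ∧ (inter x x % 4 = 3 → charSum x ≤ 8) := by
  have hx : (fun i => decide (Odd (x i))) = ![decide (Odd (x 0)), decide (Odd (x 1)),
      decide (Odd (x 2)), decide (Odd (x 3)), decide (Odd (x 4)), decide (Odd (x 5)),
      decide (Odd (x 6)), decide (Odd (x 7)), decide (Odd (x 8))] := by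
    ext i; fin_cases i <;> rfl
  have hsq : ∀ n : ℤ, ∃ k, n * n = (decide (Odd n)).toInt + 4 * k := fun n => by
    rcases Int.even_or_odd' n with ⟨k, rfl | rfl⟩
    · refine ⟨k * k, ?_⟩
      rw [decide_eq_false (Int.not_odd_iff_even.2 (even_two_mul k)), Bool.toInt_false]
      ring
    · exact ⟨k * k + k, by simp; ring⟩
  have hb := charVal_bounds (decide (Odd (x 0))) (decide (Odd (x 1)))
    (decide (Odd (x 2))) (decide (Odd (x 3))) (decide (Odd (x 4))) (decide (Odd (x 5)))
    (decide (Odd (x 6))) (decide (Odd (x 7))) (decide (Odd (x 8)))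
  rw [charSum_eq_charVal, hx]
  refine ⟨hb.1, fun h => hb.2 ?_⟩
  choose k hk using hsq
  have hxx : inter x x = x 0 * x 0 - (x 1 * x 1 + x 2 * x 2 + x 3 * x 3 + x 4 * x 4 +
      x 5 * x 5 + x 6 * x 6 + x 7 * x 7 + x 8 * x 8) := by
    rw [inter, Fin.sum_univ_eight]; rfl
  rw [← h, hxx]
  simp only [hk]
  omega

/-- Three lines that pairwise intersect in 1 all pair oddly with some root. -/
theorem exists_root_odd {a b c : Pic} (ha : IsLine a) (hb : IsLine b) (hc : IsLine c)
    (hab : inter a b = 1) (hac : inter a c = 1) (hbc : inter b c = 1) :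
    ∃ s, IsRoot s ∧ Odd (inter s a) ∧ Odd (inter s b) ∧ Odd (inter s c) := by
  by_contra! hno
  have hterm : ∀ s ∈ posRoots,
      1 + sgn (inter s (a + b)) + sgn (inter s (a + c)) + sgn (inter s (b + c)) =
        sgn (inter s a) + sgn (inter s b) + sgn (inter s c) + sgn (inter s (a + b + c)) := by
    intro s hs
    have hr := hno s (isRoot_of_mem_posRoots s hs)
    simp only [inter_add_right, sgn_add]
    rcases sgn_eq_one_or_odd (inter s a) with h | h1
    · rw [h]; ring
    rcases sgn_eq_one_or_odd (inter s b) with h | h2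
    · rw [h]; ring
    rcases sgn_eq_one_or_odd (inter s c) with h | h3
    · rw [h]; ring
    exact absurd h3 (hr h1 h2)
  have hsum := congrArg List.sum (List.map_congr_left hterm)
  simp only [List.sum_map_add, List.map_const', List.sum_replicate, length_posRoots] at hsum
  have h1 := (charSum_bounds (a + b)).1
  have h2 := (charSum_bounds (a + c)).1
  have h3 := (charSum_bounds (b + c)).1
  have h4 := (charSum_bounds a).2 (by rw [ha.1]; rfl)
  have h5 := (charSum_bounds b).2 (by rw [hb.1]; rfl)
  have h6 := (charSum_bounds c).2 (by rw [hc.1]; rfl)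
  have h7 := (charSum_bounds (a + b + c)).2 (by
    simp only [inter_add_left, inter_add_right, inter_comm b a, inter_comm c a, inter_comm c b,
      ha.1, hb.1, hc.1, hab, hac, hbc]
    rfl)
  unfold charSum at h1 h2 h3 h4 h5 h6 h7
  norm_num at hsum
  linarith

theorem IsRoot.add {r s : Pic} (hr : IsRoot r) (hs : IsRoot s) (h : inter r s = 1) :
    IsRoot (r + s) := by
  have := inter_comm r s
  constructor <;> simp only [inter_add_left, inter_add_right, hr.1, hr.2, hs.1, hs.2] <;>
    linarith

/-- A root pairing oddly with a root `r` can be moved along `r` so that it pairs to `-1`. -/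
theorem IsRoot.exists_inter_eq_neg_one {r s : Pic} (hr : IsRoot r) (hs : IsRoot s)
    (h : Odd (inter s r)) :
    ∃ t, IsRoot t ∧ inter t r = -1 ∧ ∀ x, inter r x = 0 → inter t x = inter s x := by
  rcases hs.inter_eq_of_odd hr h with h | h
  · refine ⟨s + r, hs.add hr h, ?_, fun x hx => ?_⟩
    · rw [inter_add_left, h, hr.1]; rfl
    · rw [inter_add_left, hx, add_zero]
  · exact ⟨s, hs, h, fun _ _ => rfl⟩

theorem exists_root_neg_one {a b c : Pic} (ha : IsRoot a) (hb : IsRoot b) (hc : IsRoot c)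
    (hab : inter a b = 0) (hac : inter a c = 0) (hbc : inter b c = 0) :
    ∃ s, IsRoot s ∧ inter s a = -1 ∧ inter s b = -1 ∧ inter s c = -1 := by
  have hl : ∀ {x y : Pic}, IsRoot x → IsRoot y → inter x y = 0 → inter (x - K) (y - K) = 1 :=
    fun {x y} hx hy h => by
      simp only [inter_sub_left, inter_sub_right, h, hx.2, inter_comm K y, hy.2, inter_K_K]; rfl
  obtain ⟨s, hs, h1, h2, h3⟩ := exists_root_odd ha.isLine hb.isLine hc.isLine
    (hl ha hb hab) (hl ha hc hac) (hl hb hc hbc)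
  simp only [inter_sub_right, hs.2, sub_zero] at h1 h2 h3
  obtain ⟨t, ht, hta, ht'⟩ := ha.exists_inter_eq_neg_one hs h1
  obtain ⟨u, hu, hub, hu'⟩ := hb.exists_inter_eq_neg_one ht (by rwa [ht' b hab])
  obtain ⟨v, hv, hvc, hv'⟩ := hc.exists_inter_eq_neg_one hu (by rwa [hu' c hbc, ht' c hac])
  refine ⟨v, hv, ?_, ?_, hvc⟩
  · rw [hv' a (by rw [inter_comm, hac]), hu' a (by rw [inter_comm, hab]), hta]
  · rw [hv' b (by rw [inter_comm, hbc]), hub]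

/-- If no root pairs to `-1` with each of four orthogonal roots, then some root pairs to `-1`
with the first three and is orthogonal to the last. -/
theorem exists_root_orthogonal_last {a b c d : Pic} (ha : IsRoot a) (hb : IsRoot b)
    (hc : IsRoot c) (hd : IsRoot d) (hab : inter a b = 0) (hac : inter a c = 0)
    (had : inter a d = 0) (hbc : inter b c = 0) (hbd : inter b d = 0) (hcd : inter c d = 0)
    (hno : ¬ ∃ s, IsRoot s ∧ inter s a = -1 ∧ inter s b = -1 ∧ inter s c = -1 ∧
      inter s d = -1) :
    ∃ s, IsRoot s ∧ inter s a = -1 ∧ inter s b = -1 ∧ inter s c = -1 ∧ inter s d = 0 := by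
  obtain ⟨s, hs, hsa, hsb, hsc⟩ := exists_root_neg_one ha hb hc hab hac hbc
  refine ⟨s, hs, hsa, hsb, hsc, ?_⟩
  have hodd : ¬ Odd (inter s d) := fun h => by
    obtain ⟨t, ht, htd, ht'⟩ := hd.exists_inter_eq_neg_one hs h
    refine hno ⟨t, ht, ?_, ?_, ?_, htd⟩
    · rw [ht' a (by rw [inter_comm, had]), hsa]
    · rw [ht' b (by rw [inter_comm, hbd]), hsb]
    · rw [ht' c (by rw [inter_comm, hcd]), hsc]
  have hp := inter_self_nonpos (x := 2 • s - a - b - c + d) (by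
    simp only [inter_add_left, inter_sub_left, inter_smul_left, hs.2, ha.2, hb.2, hc.2, hd.2]
    rfl)
  have hm := inter_self_nonpos (x := 2 • s - a - b - c - d) (by
    simp only [inter_sub_left, inter_smul_left, hs.2, ha.2, hb.2, hc.2, hd.2]
    rfl)
  simp only [inter_add_left, inter_sub_left, inter_add_right, inter_sub_right, inter_smul_left,
    inter_smul_right, inter_comm b a, inter_comm c a, inter_comm c b, inter_comm d a,
    inter_comm d b, inter_comm d c, inter_comm a s, inter_comm b s, inter_comm c s,
    inter_comm d s, hs.1, ha.1, hb.1, hc.1, hd.1, hab, hac, had, hbc, hbd, hcd, hsa, hsb, hsc,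
    Nat.cast_ofNat] at hp hm
  rw [Int.odd_iff] at hodd
  omega

theorem inter_root_sum {a : Fin 4 → Pic} (ha : ∀ i, IsRoot (a i))
    (haa : ∀ i j, i ≠ j → inter (a i) (a j) = 0) (i : Fin 4) :
    inter (a i) (∑ j, a j) = -2 := by
  rw [inter_sum_right, Finset.sum_eq_single i (fun j _ h => haa i j h.symm) (by simp), (ha i).1]

theorem inter_sum_sum {a : Fin 4 → Pic} (ha : ∀ i, IsRoot (a i))
    (haa : ∀ i j, i ≠ j → inter (a i) (a j) = 0) :
    inter (∑ j, a j) (∑ j, a j) = -8 := by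
  rw [inter_sum_right]
  simp only [inter_comm _ (a _), inter_root_sum ha haa]
  rfl

theorem sum_inter_K {a : Fin 4 → Pic} (ha : ∀ i, IsRoot (a i)) : inter (∑ j, a j) K = 0 := by
  rw [inter_comm, inter_sum_right]
  exact Finset.sum_eq_zero fun i _ => by rw [inter_comm, (ha i).2]

/-- Three times the sum of four uncornered orthogonal roots is `8K` plus a skew 8-line. -/
theorem exists_skew_eight_line {a : Fin 4 → Pic} (ha : ∀ i, IsRoot (a i))
    (haa : ∀ i j, i ≠ j → inter (a i) (a j) = 0)
    (hno : ¬ ∃ s, IsRoot s ∧ ∀ i, inter s (a i) = -1) :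
    ∃ m : Fin 8 → Pic, Function.Injective m ∧ (∀ i, IsLine (m i)) ∧
      (∀ i j, i ≠ j → inter (m i) (m j) = 0) ∧ 3 • ∑ i, a i = ∑ i, m i + 8 • K := by
  have hex : ∀ i, ∃ s, IsRoot s ∧ ∀ j, inter s (a j) = if i = j then 0 else -1 := by
    have key : ∀ i j k l : Fin 4, i ≠ j → i ≠ k → i ≠ l → j ≠ k → j ≠ l → k ≠ l →
        (∀ x, x = i ∨ x = j ∨ x = k ∨ x = l) →
        ∃ s, IsRoot s ∧ ∀ x, inter s (a x) = if i = x then 0 else -1 := by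
      intro i j k l hij hik hil hjk hjl hkl hall
      obtain ⟨s, hs, h1, h2, h3, h4⟩ := exists_root_orthogonal_last (ha j) (ha k) (ha l) (ha i)
        (haa _ _ hjk) (haa _ _ hjl) (haa _ _ hij.symm) (haa _ _ hkl) (haa _ _ hik.symm)
        (haa _ _ hil.symm) (by
          rintro ⟨s, hs, h1, h2, h3, h4⟩
          refine hno ⟨s, hs, fun x => ?_⟩
          rcases hall x with rfl | rfl | rfl | rfl <;> assumption)
      refine ⟨s, hs, fun x => ?_⟩
      rcases hall x with rfl | rfl | rfl | rfl
      · rw [if_pos rfl, h4]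
      · rw [if_neg hij, h1]
      · rw [if_neg hik, h2]
      · rw [if_neg hil, h3]
    intro i
    refine key i (i + 1) (i + 2) (i + 3) ?_ ?_ ?_ ?_ ?_ ?_ ?_ <;> revert i <;> decide
  choose s hs hsa using hex
  have hRa := inter_root_sum ha haa
  have hRR := inter_sum_sum ha haa
  have hRK := sum_inter_K ha
  have hsR : ∀ i, inter (s i) (∑ j, a j) = -3 := fun i => by
    simp only [inter_sum_right, hsa]
    revert i; decide
  set R := ∑ j, a j with hR
  have hss : ∀ i j, i ≠ j → inter (s i) (s j) = -1 := fun i j hij => by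
    have hp := inter_self_nonpos (x := 2 • s i - 2 • s j + a i - a j) (by
      simp only [inter_add_left, inter_sub_left, inter_smul_left, (hs _).2, (ha _).2]; rfl)
    have hm := inter_self_nonpos (x := 2 • s i + 2 • s j + a i + a j - 2 • R) (by
      simp only [inter_add_left, inter_sub_left, inter_smul_left, (hs _).2, (ha _).2, hRK]; rfl)
    simp only [inter_add_left, inter_sub_left, inter_add_right, inter_sub_right,
      inter_smul_left, inter_smul_right, inter_comm (a _) (s _), inter_comm R (a _),
      inter_comm R (s _), inter_comm (s j) (s i), hsa, hsR, hRa, (hs _).1, (ha _).1,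
      haa i j hij, haa j i hij.symm,
      hRR, if_neg hij, if_neg hij.symm, if_true, Nat.cast_ofNat] at hp hm
    omega
  let t : Fin 4 ⊕ Fin 4 → Pic := Sum.elim s fun i => R - a i - s i
  have ht : ∀ i, IsRoot (t i) := by
    rintro (i | i)
    · exact hs i
    · constructor
      · simp [t, inter_sub_left, inter_sub_right, inter_comm (a _) (s _), inter_comm R (a _),
          inter_comm R (s _), hsa, hsR, hRa, hRR, (hs _).1, (ha _).1]
      · simp [t, inter_sub_left, hRK, (hs _).2, (ha _).2]
  have htt : ∀ i j, i ≠ j → inter (t i) (t j) = -1 := by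
    rintro (i | i) (j | j) hij
    · exact hss i j fun h => hij (h ▸ rfl)
    · by_cases h : i = j
      · subst h
        simp [t, inter_sub_right, hsR, hsa, (hs _).1]
      · simp [t, inter_sub_right, hsR, hsa, hss i j h, h]
    · by_cases h : i = j
      · subst h
        simp [t, inter_sub_left, inter_comm R (s _), inter_comm (a _), hsR, hsa, (hs _).1]
      · simp [t, inter_sub_left, inter_comm R (s _), inter_comm (a _), hsR, hsa, hss i j h,
          Ne.symm h]
    · have h : i ≠ j := fun h => hij (h ▸ rfl)
      simp [t, inter_sub_left, inter_sub_right, inter_comm R (a _), inter_comm R (s _),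
        inter_comm (a _) (s _), hsR, hsa, hRa, hRR, hss i j h, haa i j h, h, h.symm]
  let m : Fin 8 → Pic := fun i => t (finSumFinEquiv.symm i) - K
  have hline : ∀ i, IsLine (m i) := fun i => (ht _).isLine
  have hskew : ∀ i j, i ≠ j → inter (m i) (m j) = 0 := fun i j hij => by
    simp only [m, inter_sub_left, inter_sub_right, inter_comm K (t _), (ht _).2, inter_K_K,
      htt _ _ fun h => hij (finSumFinEquiv.symm.injective h)]
    rfl
  refine ⟨m, fun i j h => ?_, hline, hskew, ?_⟩
  · by_contra hij
    have h0 := hskew i j hij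
    rw [← h, (hline i).1] at h0
    exact absurd h0 (by decide)
  · have hsum : ∑ i, t i = 3 • R := by
      simp only [t, Fintype.sum_sum_type, Sum.elim_inl, Sum.elim_inr, Finset.sum_sub_distrib,
        ← hR, Finset.sum_const, Finset.card_univ, Fintype.card_fin]
      abel
    simp only [m, Finset.sum_sub_distrib, Finset.sum_const, Finset.card_univ, Fintype.card_fin]
    rw [Equiv.sum_comp finSumFinEquiv.symm t, hsum, sub_add_cancel]

theorem uncornered_iff_skew_eight_line (l : Fin 4 → Pic)
    (hinj : Function.Injective l)
    (hline : ∀ i, IsLine (l i))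
    (hint : ∀ i j, i ≠ j → inter (l i) (l j) = 1) :
    (∃ m : Fin 8 → Pic, Function.Injective m ∧ (∀ i, IsLine (m i)) ∧
        (∀ i j, i ≠ j → inter (m i) (m j) = 0) ∧
        3 • (∑ i, l i) + 4 • K = ∑ i, m i) ↔
      ¬ ∃ n : Pic, IsLine n ∧ ∀ i, inter n (l i) = 0 := by
  have ha : ∀ i, IsRoot (l i + K) := fun i => (hline i).isRoot
  have haa : ∀ i j, i ≠ j → inter (l i + K) (l j + K) = 0 := fun i j hij => by
    simp only [inter_add_left, inter_add_right, inter_comm K (l _), (hline _).2, hint i j hij,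
      inter_K_K]
    rfl
  have hD : ∑ i, (l i + K) = ∑ i, l i + 4 • K := by
    simp [Finset.sum_add_distrib]
  constructor
  · rintro ⟨m, -, hm, hskew, hsum⟩ ⟨n, hn, hnl⟩
    have hnR : inter (n + K) (∑ i, (l i + K)) = -4 := by
      simp only [inter_sum_right, inter_add_left, inter_add_right, inter_comm K (l _),
        (hline _).2, hnl, hn.2, inter_K_K]
      rfl
    have hz : ∑ i, (l i + K) - 2 • (n + K) = 0 := by
      apply eq_zero_of_inter_self
      · rw [inter_sub_left, inter_smul_left, sum_inter_K ha, hn.isRoot.2]; rfl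
      · simp only [inter_sub_left, inter_sub_right, inter_smul_left, inter_smul_right,
          inter_sum_sum ha haa, inter_comm _ (n + K), hnR, hn.isRoot.1]
        rfl
    have hD2 : ∑ i, l i = 2 • (n + K) - 4 • K := by
      rw [← sub_eq_zero.1 hz, hD, add_sub_cancel_right]
    have hm0 : inter (m 0) (∑ i, m i) = -1 := by
      rw [inter_sum_right, Finset.sum_eq_single 0 (fun j _ h => hskew 0 j h.symm) (by simp),
        (hm 0).1]
    rw [← hsum, hD2] at hm0
    simp only [inter_add_right, inter_sub_right, inter_smul_right, (hm 0).2,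
      Nat.cast_ofNat] at hm0
    omega
  · intro hno
    obtain ⟨m, hm, hml, hskew, hsum⟩ := exists_skew_eight_line ha haa (by
      rintro ⟨s, hs, hsl⟩
      refine hno ⟨s - K, hs.isLine, fun i => ?_⟩
      have h := hsl i
      rw [inter_add_right, hs.2] at h
      rw [inter_sub_left, inter_comm K, (hline i).2]
      linarith)
    refine ⟨m, hm, hml, hskew, ?_⟩
    rw [← add_right_cancel_iff (a := 8 • K), ← hsum, hD]
    abel

end DelPezzo
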